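/- Let p ∈ [0.248, 1/2), and define c_1 = (p²−p−1)/(p²+p+1), c_2 = (p²−3p+1)/(p²+p+1), c_3 = (5p²−27p+45−28/p+6/p²)/(4(p²+p+1)). For a graph G ⊆ E_n, set λ(G) = (−p/(1−p))^(|G|)·[q_0(G) + c_1·q_1(G) + c_2·q_2(G) + c_3·q_3(G)]. Then: (i) λ(∅) = 1; (ii) for every nonempty G, λ(G) ≥ −p³/(1−p³), with equality if and only if G is a single edge, a path of length two, two disjoint edges, or a triangle; (iii) there exists γ′ > 0, independent of n and of p, such that for every G which has at least one edge, is not a single edge, a path of length two, two disjoint edges, or a triangle, and is neither a forest with exactly 4 edges nor isomorphic to K_4^−, one has λ(G) ≥ −p³/(1−p³) + γ′. -/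

import Mathlib

/-- The edge set of the complete graph `K_n` on vertex set `Fin n`:
all non-diagonal unordered pairs. -/
def edgeFinset (n : ℕ) : Finset (Sym2 (Fin n)) :=
  Finset.univ.filter (fun e => ¬ e.IsDiag)

/-- `T` is a triangle: the three edges on three distinct vertices. -/
def IsTriangle {n : ℕ} (T : Finset (Sym2 (Fin n))) : Prop :=
  ∃ a b c : Fin n, a ≠ b ∧ a ≠ c ∧ b ≠ c ∧ T = {s(a, b), s(a, c), s(b, c)}

/-- `G` is a path of length two. -/
def IsPathTwo {n : ℕ} (G : Finset (Sym2 (Fin n))) : Prop :=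
  ∃ a b c : Fin n, a ≠ b ∧ a ≠ c ∧ b ≠ c ∧ G = {s(a, b), s(b, c)}

/-- `G` consists of two disjoint edges. -/
def IsTwoDisjointEdges {n : ℕ} (G : Finset (Sym2 (Fin n))) : Prop :=
  ∃ a b c d : Fin n, a ≠ b ∧ a ≠ c ∧ a ≠ d ∧ b ≠ c ∧ b ≠ d ∧ c ≠ d ∧
    G = {s(a, b), s(c, d)}

/-- `G` is (a copy of) `K_4^-`, the complete graph on four vertices minus an edge. -/
def IsK4Minus {n : ℕ} (G : Finset (Sym2 (Fin n))) : Prop :=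
  ∃ a b c d : Fin n, a ≠ b ∧ a ≠ c ∧ a ≠ d ∧ b ≠ c ∧ b ≠ d ∧ c ≠ d ∧
    G = {s(a, b), s(a, c), s(a, d), s(b, c), s(c, d)}

/-- The simple graph on `Fin n` with edge set `G`. -/
def graphOf {n : ℕ} (G : Finset (Sym2 (Fin n))) : SimpleGraph (Fin n) :=
  SimpleGraph.fromEdgeSet (G : Set (Sym2 (Fin n)))

/-- `G` is a forest: it contains no cycle. -/
def IsForest {n : ℕ} (G : Finset (Sym2 (Fin n))) : Prop :=
  (graphOf G).IsAcyclic

/-- The cut of `G` determined by a two-colouring `c` of the vertices: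
the set of edges of `G` with differently-coloured endpoints. -/
def cutOf {n : ℕ} (c : Fin n → Bool) (G : Finset (Sym2 (Fin n))) :
    Finset (Sym2 (Fin n)) :=
  G.filter fun e =>
    Sym2.lift ⟨fun i j => xor (c i) (c j), fun _ _ => Bool.xor_comm _ _⟩ e = true

/-- `q_k(G)`: the probability, over a uniformly random `c : [n] → {0,1}`,
that the cut of `G` determined by `c` has exactly `k` edges. -/
noncomputable def qk (n : ℕ) (k : ℕ) (G : Finset (Sym2 (Fin n))) : ℝ :=
  ((Finset.univ.filter
      (fun c : Fin n → Bool => (cutOf c G).card = k)).card : ℝ) / 2 ^ n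

/-- The eigenvalue `λ(G)` of the skewed OCC spectrum, for bias `p`. -/
noncomputable def lamP (n : ℕ) (p : ℝ) (G : Finset (Sym2 (Fin n))) : ℝ :=
  (-(p / (1 - p))) ^ G.card *
    (qk n 0 G
      + ((p ^ 2 - p - 1) / (p ^ 2 + p + 1)) * qk n 1 G
      + ((p ^ 2 - 3 * p + 1) / (p ^ 2 + p + 1)) * qk n 2 G
      + ((5 * p ^ 2 - 27 * p + 45 - 28 / p + 6 / p ^ 2) / (4 * (p ^ 2 + p + 1)))
          * qk n 3 G)

variable {n : ℕ} {G T : Finset (Sym2 (Fin n))}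

/-- `G` has no loops. -/
def Loopless {n : ℕ} (G : Finset (Sym2 (Fin n))) : Prop := ∀ e ∈ G, ¬ e.IsDiag

/-- The family of all cuts of `G`. -/
def cuts {n : ℕ} (G : Finset (Sym2 (Fin n))) : Finset (Finset (Sym2 (Fin n))) :=
  Finset.univ.image fun c : Fin n → Bool => cutOf c G

/-- Every set of edges of `T` is a cut of `T`; equivalently, `T` is a forest. -/
def Shattered {n : ℕ} (T : Finset (Sym2 (Fin n))) : Prop := ∀ A ⊆ T, A ∈ cuts T

/-- The bridges of `G`: the edges that form a cut on their own. -/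
def bridges {n : ℕ} (G : Finset (Sym2 (Fin n))) : Finset (Sym2 (Fin n)) :=
  G.filter fun e => {e} ∈ cuts G

theorem mk_mem_cutOf {c : Fin n → Bool} {i j : Fin n} :
    s(i, j) ∈ cutOf c G ↔ s(i, j) ∈ G ∧ c i ≠ c j := by
  simp [cutOf]

theorem cutOf_subset (c : Fin n → Bool) (G : Finset (Sym2 (Fin n))) : cutOf c G ⊆ G :=
  Finset.filter_subset _ _

theorem cutOf_mem_cuts (c : Fin n → Bool) (G : Finset (Sym2 (Fin n))) : cutOf c G ∈ cuts G :=
  Finset.mem_image_of_mem _ (Finset.mem_univ c)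

theorem mem_cuts {A : Finset (Sym2 (Fin n))} : A ∈ cuts G ↔ ∃ c, cutOf c G = A := by
  simp [cuts]

theorem cutOf_inter_of_subset (c : Fin n → Bool) (h : T ⊆ G) :
    cutOf c T = cutOf c G ∩ T := by
  ext e
  simp only [cutOf, Finset.mem_filter, Finset.mem_inter]
  have := @h e
  tauto

theorem cutOf_xor (c d : Fin n → Bool) (G : Finset (Sym2 (Fin n))) :
    cutOf (fun v => xor (c v) (d v)) G = symmDiff (cutOf c G) (cutOf d G) := by
  ext e
  induction e with
  | _ i j =>
    rw [Finset.mem_symmDiff, mk_mem_cutOf, mk_mem_cutOf, mk_mem_cutOf]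
    cases c i <;> cases c j <;> cases d i <;> cases d j <;> simp

theorem symmDiff_mem_cuts {A B : Finset (Sym2 (Fin n))} (hA : A ∈ cuts G) (hB : B ∈ cuts G) :
    symmDiff A B ∈ cuts G := by
  obtain ⟨c, rfl⟩ := mem_cuts.1 hA
  obtain ⟨d, rfl⟩ := mem_cuts.1 hB
  exact mem_cuts.2 ⟨_, cutOf_xor c d G⟩

theorem empty_mem_cuts (G : Finset (Sym2 (Fin n))) : ∅ ∈ cuts G := by
  refine mem_cuts.2 ⟨fun _ => false, ?_⟩
  ext e
  induction e with
  | _ i j => simp [mk_mem_cutOf]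

theorem card_colorings_eq {A : Finset (Sym2 (Fin n))} (hA : A ∈ cuts G) :
    (Finset.univ.filter fun c : Fin n → Bool => cutOf c G = A).card =
      (Finset.univ.filter fun c : Fin n → Bool => cutOf c G = ∅).card := by
  obtain ⟨d, rfl⟩ := mem_cuts.1 hA
  refine Finset.card_nbij' (fun c v => xor (c v) (d v)) (fun c v => xor (c v) (d v)) ?_ ?_ ?_ ?_
  · intro c hc
    simp only [Finset.coe_filter, Finset.mem_univ, true_and, Set.mem_ofPred_eq] at hc ⊢
    rw [cutOf_xor, hc, symmDiff_self]; rfl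
  · intro c hc
    simp only [Finset.coe_filter, Finset.mem_univ, true_and, Set.mem_ofPred_eq] at hc ⊢
    rw [cutOf_xor, hc, ← Finset.bot_eq_empty, bot_symmDiff]
  · intro c _
    funext v
    simp
  · intro c _
    funext v
    simp

/-- The cut of a uniformly random colouring is uniform on the family of cuts. -/
theorem qk_eq (k : ℕ) (G : Finset (Sym2 (Fin n))) :
    qk n k G = ((cuts G).filter fun A => A.card = k).card * qk n 0 G := by
  have h : (Finset.univ.filter fun c : Fin n → Bool => (cutOf c G).card = k).card =
      ((cuts G).filter fun A => A.card = k).card *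
        (Finset.univ.filter fun c : Fin n → Bool => cutOf c G = ∅).card := by
    rw [Finset.card_eq_sum_card_fiberwise (f := fun c => cutOf c G)
      (t := (cuts G).filter fun A => A.card = k)]
    · rw [Finset.sum_const_nat]
      intro A hA
      rw [Finset.mem_filter] at hA
      rw [← card_colorings_eq hA.1, Finset.filter_filter]
      congr 1
      ext c
      simp only [Finset.mem_filter, Finset.mem_univ, true_and]
      constructor
      · exact fun h => h.2
      · rintro rfl
        exact ⟨hA.2, rfl⟩
    · intro c hc
      simp only [Finset.coe_filter, Finset.mem_univ, true_and, Set.mem_ofPred_eq] at hc ⊢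
      exact ⟨cutOf_mem_cuts c G, hc⟩
  simp only [qk, h, Finset.card_eq_zero]
  push_cast
  ring

theorem card_cuts_mul (G : Finset (Sym2 (Fin n))) : (cuts G).card * qk n 0 G = 1 := by
  have h : (Finset.univ : Finset (Fin n → Bool)).card = (cuts G).card *
        (Finset.univ.filter fun c : Fin n → Bool => cutOf c G = ∅).card := by
    rw [Finset.card_eq_sum_card_fiberwise (f := fun c => cutOf c G) (t := cuts G)]
    · exact Finset.sum_const_nat fun A hA => card_colorings_eq hA
    · intro c _
      exact cutOf_mem_cuts c G
  have h' : ((2 : ℝ) ^ n) = (cuts G).card *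
        (Finset.univ.filter fun c : Fin n → Bool => cutOf c G = ∅).card := by
    rw [← Nat.cast_mul, ← h]
    simp
  simp only [qk, Finset.card_eq_zero]
  rw [← mul_div_assoc, ← h', div_self (by positivity)]

theorem card_cuts_pos (G : Finset (Sym2 (Fin n))) : 0 < (cuts G).card :=
  Finset.card_pos.2 ⟨∅, empty_mem_cuts G⟩

theorem qk_zero_eq (G : Finset (Sym2 (Fin n))) : qk n 0 G = 1 / (cuts G).card := by
  have := card_cuts_pos G
  rw [eq_div_iff (by positivity), mul_comm, card_cuts_mul]

theorem qk_zero_pos (G : Finset (Sym2 (Fin n))) : 0 < qk n 0 G := by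
  have := card_cuts_pos G
  rw [qk_zero_eq]
  positivity

theorem qk_eq_div (k : ℕ) (G : Finset (Sym2 (Fin n))) :
    qk n k G = ((cuts G).filter fun A => A.card = k).card / (cuts G).card := by
  rw [qk_eq, qk_zero_eq, mul_one_div]

theorem qk_nonneg (k : ℕ) (G : Finset (Sym2 (Fin n))) : 0 ≤ qk n k G := by
  unfold qk
  positivity

theorem card_symmDiff_add {α : Type*} [DecidableEq α] (s t : Finset α) :
    (symmDiff s t).card + 2 * (s ∩ t).card = s.card + t.card := by
  have h1 : (symmDiff s t).card = (s \ t).card + (t \ s).card := by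
    rw [symmDiff_def, Finset.sup_eq_union, Finset.card_union_of_disjoint]
    exact disjoint_sdiff_sdiff
  have h2 := Finset.card_sdiff_add_card_inter s t
  have h3 := Finset.card_sdiff_add_card_inter t s
  rw [Finset.inter_comm] at h3
  omega

/-- If some cut has odd size then exactly half of the cuts have even size. -/
theorem two_mul_card_filter_even {A : Finset (Sym2 (Fin n))} (hA : A ∈ cuts G)
    (hodd : Odd A.card) :
    2 * ((cuts G).filter fun B => Even B.card).card = (cuts G).card := by
  have key : ∀ B : Finset (Sym2 (Fin n)), Even (symmDiff B A).card ↔ ¬ Even B.card := by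
    intro B
    have h := card_symmDiff_add B A
    grind
  have h : ((cuts G).filter fun B => Even B.card).card =
      ((cuts G).filter fun B => ¬ Even B.card).card := by
    refine Finset.card_nbij' (fun B => symmDiff B A) (fun B => symmDiff B A) ?_ ?_ ?_ ?_
    · intro B hB
      simp only [Finset.coe_filter, Set.mem_ofPred_eq] at hB ⊢
      exact ⟨symmDiff_mem_cuts hB.1 hA, by rw [key]; simpa using hB.2⟩
    · intro B hB
      simp only [Finset.coe_filter, Set.mem_ofPred_eq] at hB ⊢
      exact ⟨symmDiff_mem_cuts hB.1 hA, by rw [key]; exact hB.2⟩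
    · intro B _
      simp
    · intro B _
      simp
  have := Finset.card_filter_add_card_filter_not (s := cuts G) fun B => Even B.card
  omega

theorem qk_two_le_half {A : Finset (Sym2 (Fin n))} (hA : A ∈ cuts G) (hodd : Odd A.card) :
    qk n 2 G ≤ 1 / 2 := by
  have h := two_mul_card_filter_even hA hodd
  have h2 : ((cuts G).filter fun B => B.card = 2).card ≤
      ((cuts G).filter fun B => Even B.card).card :=
    Finset.card_le_card (Finset.monotone_filter_right _ fun B _ hB => by rw [hB]; exact even_two)
  have := card_cuts_pos G
  rw [qk_eq_div, div_le_div_iff₀ (by positivity) two_pos]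
  norm_cast
  omega

theorem qk_three_le_half (G : Finset (Sym2 (Fin n))) : qk n 3 G ≤ 1 / 2 := by
  have hpos := card_cuts_pos G
  rw [qk_eq_div, div_le_div_iff₀ (by positivity) two_pos]
  norm_cast
  obtain h0 | ⟨A, hA⟩ := ((cuts G).filter fun B => B.card = 3).eq_empty_or_nonempty
  · rw [h0]; simp
  · rw [Finset.mem_filter] at hA
    have h := two_mul_card_filter_even hA.1 (by rw [hA.2]; decide)
    have h2 : ((cuts G).filter fun B => B.card = 3).card ≤
        ((cuts G).filter fun B => ¬ Even B.card).card :=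
      Finset.card_le_card (Finset.monotone_filter_right _ fun B _ hB => by rw [hB]; decide)
    have := Finset.card_filter_add_card_filter_not (s := cuts G) fun B => Even B.card
    omega

theorem Shattered.cuts_eq (h : Shattered T) : cuts T = T.powerset := by
  ext A
  rw [Finset.mem_powerset]
  refine ⟨fun hA => ?_, h A⟩
  obtain ⟨c, rfl⟩ := mem_cuts.1 hA
  exact cutOf_subset c T

theorem Shattered.qk_eq (h : Shattered T) (k : ℕ) : qk n k T = T.card.choose k / 2 ^ T.card := by
  rw [qk_eq_div, h.cuts_eq, ← Finset.powersetCard_eq_filter, Finset.card_powersetCard,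
    Finset.card_powerset]
  push_cast
  rfl

theorem card_cuts_mono (h : T ⊆ G) : (cuts T).card ≤ (cuts G).card := by
  refine Finset.card_le_card_of_surjOn (fun A => A ∩ T) ?_
  intro A hA
  obtain ⟨c, rfl⟩ := mem_cuts.1 hA
  exact ⟨cutOf c G, cutOf_mem_cuts c G, (cutOf_inter_of_subset c h).symm⟩

theorem Shattered.qk_zero_le (h : Shattered T) (hTG : T ⊆ G) : qk n 0 G ≤ 1 / 2 ^ T.card := by
  have h1 := card_cuts_mono hTG
  rw [h.cuts_eq, Finset.card_powerset] at h1
  rw [qk_zero_eq]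
  apply one_div_le_one_div_of_le (by positivity)
  exact_mod_cast h1

theorem shattered_empty : Shattered (∅ : Finset (Sym2 (Fin n))) := by
  intro A hA
  rw [Finset.subset_empty.1 hA]
  exact empty_mem_cuts ∅

theorem Shattered.insert (h : Shattered T) {e : Sym2 (Fin n)} (he : {e} ∈ cuts (insert e T)) :
    Shattered (insert e T) := by
  intro A hA
  by_cases heT : e ∈ T
  · rw [Finset.insert_eq_of_mem heT] at hA ⊢
    exact h A hA
  obtain ⟨c, hc⟩ := mem_cuts.1 (h (A.erase e) (Finset.subset_insert_iff.1 hA))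
  rw [cutOf_inter_of_subset c (Finset.subset_insert e T)] at hc
  have hmem := cutOf_mem_cuts c (Insert.insert e T)
  have hsub := cutOf_subset c (Insert.insert e T)
  generalize cutOf c (Insert.insert e T) = C at hc hmem hsub
  have key : ∀ f, f ≠ e → (f ∈ A ↔ f ∈ C) := by
    intro f hf
    have h1 := Finset.ext_iff.1 hc f
    grind
  by_cases hiff : e ∈ A ↔ e ∈ C
  · have : A = C := by
      ext f
      grind
    rwa [this]
  · have : A = symmDiff C {e} := by
      ext f
      rw [Finset.mem_symmDiff, Finset.mem_singleton]
      grind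
    rw [this]
    exact symmDiff_mem_cuts hmem he

/-- An edge with an endpoint of degree one is a cut. -/
theorem singleton_mem_cuts_of_unique {x y : Fin n} (hxy : x ≠ y) (hG : s(x, y) ∈ G)
    (h : ∀ z, z ≠ x → s(x, z) ∈ G → z = y) : {s(x, y)} ∈ cuts G := by
  refine mem_cuts.2 ⟨fun v => decide (v = x), ?_⟩
  ext e
  induction e with
  | _ i j =>
    rw [mk_mem_cutOf, Finset.mem_singleton]
    constructor
    · rintro ⟨he, hne⟩
      by_cases hi : i = x
      · subst hi
        have hj : j ≠ i := by rintro rfl; simp at hne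
        rw [h j hj he]
      · have hj : j = x := by simpa [hi] using hne
        subst hj
        rw [Sym2.eq_swap] at he
        rw [h i hi he, Sym2.eq_swap]
    · intro he
      rw [he]
      refine ⟨hG, ?_⟩
      rw [Sym2.eq_iff] at he
      obtain ⟨rfl, rfl⟩ | ⟨rfl, rfl⟩ := he <;> simp [hxy.symm]

theorem Shattered.insert_of_forall_notMem (h : Shattered T) {x y : Fin n} (hxy : x ≠ y)
    (hx : ∀ e ∈ T, x ∉ e) : Shattered (Insert.insert s(x, y) T) := by
  refine h.insert (singleton_mem_cuts_of_unique hxy (Finset.mem_insert_self _ _) ?_)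
  intro z _ hz
  rw [Finset.mem_insert] at hz
  obtain hz | hz := hz
  · simpa [hxy] using hz
  · exact absurd (Sym2.mem_mk_left x z) (hx _ hz)

theorem shattered_singleton {e : Sym2 (Fin n)} (he : ¬ e.IsDiag) : Shattered {e} := by
  induction e with
  | _ x y =>
    rw [Sym2.mk_isDiag_iff] at he
    exact shattered_empty.insert_of_forall_notMem he (by simp)

theorem shattered_pair {e f : Sym2 (Fin n)} (he : ¬ e.IsDiag) (hf : ¬ f.IsDiag) (hef : e ≠ f) :
    Shattered {e, f} := by
  induction e with
  | _ x y =>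
    rw [Sym2.mk_isDiag_iff] at he
    by_cases hx : x ∈ f
    · by_cases hy : y ∈ f
      · exact absurd ((Sym2.mem_and_mem_iff he).1 ⟨hx, hy⟩).symm hef
      · rw [Sym2.eq_swap]
        exact (shattered_singleton hf).insert_of_forall_notMem (Ne.symm he) (by simpa using hy)
    · exact (shattered_singleton hf).insert_of_forall_notMem he (by simpa using hx)

theorem mem_bridges {e : Sym2 (Fin n)} : e ∈ bridges G ↔ e ∈ G ∧ {e} ∈ cuts G :=
  Finset.mem_filter

theorem bridges_subset (G : Finset (Sym2 (Fin n))) : bridges G ⊆ G := Finset.filter_subset _ _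

theorem singleton_mem_cuts_mono {e : Sym2 (Fin n)} (hTG : T ⊆ G) (heT : e ∈ T)
    (he : {e} ∈ cuts G) : {e} ∈ cuts T := by
  obtain ⟨c, hc⟩ := mem_cuts.1 he
  refine mem_cuts.2 ⟨c, ?_⟩
  rw [cutOf_inter_of_subset c hTG, hc, Finset.singleton_inter_of_mem heT]

theorem Shattered.union_bridges (h : Shattered T) (hTG : T ⊆ G) :
    Shattered (bridges G ∪ T) := by
  suffices H : ∀ B ⊆ bridges G, Shattered (B ∪ T) from H _ subset_rfl
  intro B
  induction B using Finset.induction_on with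
  | empty => simpa using h
  | insert e B _ ih =>
    intro hB
    have hB' : B ⊆ bridges G := (Finset.subset_insert e B).trans hB
    rw [Finset.insert_union]
    refine (ih hB').insert (singleton_mem_cuts_mono ?_ (Finset.mem_insert_self _ _)
      (mem_bridges.1 (hB (Finset.mem_insert_self e B))).2)
    rw [← Finset.insert_union]
    exact Finset.union_subset (hB.trans (bridges_subset G)) hTG

/-- Adding at most two further edges to the bridges of a loopless `G` keeps the set shattered. -/
theorem exists_shattered_card_eq (hG : Loopless G) {j : ℕ} (hj : j ≤ 2)
    (hcard : (bridges G).card + j ≤ G.card) :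
    ∃ T ⊆ G, Shattered T ∧ T.card = (bridges G).card + j := by
  have hsd : (G \ bridges G).card = G.card - (bridges G).card :=
    Finset.card_sdiff_of_subset (bridges_subset G)
  obtain ⟨S, hS, hSj⟩ := Finset.exists_subset_card_eq (s := G \ bridges G) (n := j) (by omega)
  have hSG : S ⊆ G := hS.trans Finset.sdiff_subset
  have hSs : Shattered S := by
    interval_cases j
    · rw [Finset.card_eq_zero.1 hSj]; exact shattered_empty
    · obtain ⟨e, rfl⟩ := Finset.card_eq_one.1 hSj
      exact shattered_singleton (hG e (hSG (by simp)))
    · obtain ⟨e, f, hef, rfl⟩ := Finset.card_eq_two.1 hSj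
      exact shattered_pair (hG e (hSG (by simp))) (hG f (hSG (by simp))) hef
  refine ⟨bridges G ∪ S, Finset.union_subset (bridges_subset G) hSG, hSs.union_bridges hSG, ?_⟩
  rw [Finset.card_union_of_disjoint, hSj]
  exact Finset.disjoint_of_subset_right hS Finset.disjoint_sdiff

theorem qk_zero_le_of_card (hG : Loopless G) {j : ℕ} (hj : j ≤ 2)
    (hcard : (bridges G).card + j ≤ G.card) : qk n 0 G ≤ 1 / 2 ^ ((bridges G).card + j) := by
  obtain ⟨T, hTG, hT, hTc⟩ := exists_shattered_card_eq hG hj hcard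
  rw [← hTc]
  exact hT.qk_zero_le hTG

theorem shattered_of_card_le (hG : Loopless G) (h : G.card ≤ (bridges G).card + 2) :
    Shattered G := by
  have h1 := Finset.card_le_card (bridges_subset G)
  obtain ⟨T, hTG, hT, hTc⟩ := exists_shattered_card_eq hG
    (j := G.card - (bridges G).card) (by omega) (by omega)
  rwa [← Finset.eq_of_subset_of_card_le hTG (by omega)]

theorem qk_one_eq (G : Finset (Sym2 (Fin n))) : qk n 1 G = (bridges G).card * qk n 0 G := by
  rw [qk_eq]
  congr 2
  symm
  refine Finset.card_nbij (fun e => {e}) ?_ ?_ ?_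
  · intro e he
    simpa using (mem_bridges.1 he).2
  · intro e _ f _ h
    simpa using h
  · intro A hA
    simp only [Finset.coe_filter, Set.mem_ofPred_eq] at hA
    obtain ⟨e, rfl⟩ := Finset.card_eq_one.1 hA.2
    obtain ⟨c, hc⟩ := mem_cuts.1 hA.1
    exact ⟨e, mem_bridges.2 ⟨cutOf_subset c G (by rw [hc]; simp), hA.1⟩, rfl⟩

theorem Shattered.isForest (h : Shattered G) : IsForest G := by
  refine SimpleGraph.isAcyclic_iff_forall_isBridge.2 fun e he => ?_
  induction e with
  | _ i j =>
    have heG : s(i, j) ∈ G := by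
      simpa [graphOf] using (SimpleGraph.edgeSet_fromEdgeSet (G : Set (Sym2 (Fin n))) ▸ he).1
    obtain ⟨c, hc⟩ := mem_cuts.1 (h {s(i, j)} (by simpa using heG))
    have hij : c i ≠ c j := (mk_mem_cutOf.1 (hc ▸ Finset.mem_singleton_self s(i, j))).2
    rw [SimpleGraph.isBridge_iff]
    rintro ⟨w⟩
    have key : ∀ {u v : Fin n}, ((graphOf G).deleteEdges {s(i, j)}).Walk u v → c u = c v := by
      intro u v w
      induction w with
      | nil => rfl
      | @cons u v _ hadj _ ih =>
        rw [← ih]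
        by_contra hne
        rw [SimpleGraph.deleteEdges_adj] at hadj
        have hmem : s(u, v) ∈ cutOf c G :=
          mk_mem_cutOf.2 ⟨by simpa [graphOf] using hadj.1.1, hne⟩
        rw [hc] at hmem
        exact hadj.2 (by simpa using hmem)
    exact hij (key w)

/-- The cuts of size `k` make up at most three quarters of all cuts: on each set of four cuts
obtained by flipping the two ends of a fixed edge, the size is not constant. -/
theorem qk_le_three_quarters (hG : Loopless G) (hne : G.Nonempty) (k : ℕ) :
    qk n k G ≤ 3 / 4 := by
  obtain ⟨e, he⟩ := hne
  induction e with
  | _ a b =>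
  have hab : a ≠ b := by simpa using hG _ he
  set A := cutOf (fun v => decide (v = a)) G with hA
  set B := cutOf (fun v => decide (v = b)) G with hB
  have hAB : A ∩ B = {s(a, b)} := by
    ext f
    induction f with
    | _ i j =>
      rw [Finset.mem_inter, hA, hB, mk_mem_cutOf, mk_mem_cutOf, Finset.mem_singleton,
        Sym2.eq_iff]
      constructor
      · rintro ⟨⟨_, h1⟩, _, h2⟩
        by_cases i = a <;> by_cases i = b <;> by_cases j = a <;> by_cases j = b <;> simp_all
      · rintro (⟨rfl, rfl⟩ | ⟨rfl, rfl⟩)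
        · simp [he, hab, hab.symm]
        · rw [Sym2.eq_swap] at he
          simp [he, hab, hab.symm]
  have hAc : A ∈ cuts G := cutOf_mem_cuts _ _
  have hBc : B ∈ cuts G := cutOf_mem_cuts _ _
  set Y := (cuts G).filter fun C => ¬ C.card = k with hY
  have hcover : cuts G ⊆ (Y ∪ Y.image (symmDiff · A)) ∪
      (Y.image (symmDiff · B) ∪ Y.image (symmDiff · (symmDiff A B))) := by
    intro C hC
    have mem_of {D : Finset (Sym2 (Fin n))} (hD : D ∈ cuts G) (h : ¬ (symmDiff C D).card = k) :
        C ∈ Y.image (symmDiff · D) :=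
      Finset.mem_image.2 ⟨symmDiff C D,
        Finset.mem_filter.2 ⟨symmDiff_mem_cuts hC hD, h⟩, symmDiff_symmDiff_cancel_right D C⟩
    by_contra hnot
    simp only [Finset.mem_union, not_or] at hnot
    obtain ⟨⟨h0, h1⟩, h2, h3⟩ := hnot
    replace h0 : C.card = k := by
      by_contra h
      exact h0 (Finset.mem_filter.2 ⟨hC, h⟩)
    replace h1 : (symmDiff C A).card = k := by
      by_contra h
      exact h1 (mem_of hAc h)
    replace h2 : (symmDiff C B).card = k := by
      by_contra h
      exact h2 (mem_of hBc h)
    replace h3 : (symmDiff C (symmDiff A B)).card = k := by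
      by_contra h
      exact h3 (mem_of (symmDiff_mem_cuts hAc hBc) h)
    have e1 := card_symmDiff_add C A
    have e2 := card_symmDiff_add C B
    have e3 := card_symmDiff_add C (symmDiff A B)
    have e4 := card_symmDiff_add A B
    have e5 := card_symmDiff_add (C ∩ A) (C ∩ B)
    have e6 : symmDiff (C ∩ A) (C ∩ B) = C ∩ symmDiff A B := by
      ext f
      simp only [Finset.mem_symmDiff, Finset.mem_inter]
      tauto
    rw [hAB, Finset.card_singleton] at e4
    rw [e6] at e5
    omega
  have hY4 : (cuts G).card ≤ 4 * Y.card := by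
    have h1 := Finset.card_le_card hcover
    have h2 := Finset.card_union_le (Y ∪ Y.image (symmDiff · A))
      (Y.image (symmDiff · B) ∪ Y.image (symmDiff · (symmDiff A B)))
    have h3 := Finset.card_union_le Y (Y.image (symmDiff · A))
    have h4 := Finset.card_union_le (Y.image (symmDiff · B))
      (Y.image (symmDiff · (symmDiff A B)))
    have h5 := Finset.card_image_le (s := Y) (f := (symmDiff · A))
    have h6 := Finset.card_image_le (s := Y) (f := (symmDiff · B))
    have h7 := Finset.card_image_le (s := Y) (f := (symmDiff · (symmDiff A B)))
    omega
  have hsum : ((cuts G).filter fun C => C.card = k).card + Y.card = (cuts G).card :=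
    Finset.card_filter_add_card_filter_not (s := cuts G) fun C => C.card = k
  have hpos := card_cuts_pos G
  rw [qk_eq_div, div_le_div_iff₀ (by positivity) (by norm_num)]
  norm_cast
  omega

/-- In a bridgeless graph every vertex on an edge lies on a second edge. -/
theorem exists_second_edge (hG : Loopless G) (hb : bridges G = ∅) {x y : Fin n}
    (hxy : s(x, y) ∈ G) : ∃ z, z ≠ x ∧ z ≠ y ∧ s(x, z) ∈ G := by
  by_contra! h
  have hne : x ≠ y := by simpa using hG _ hxy
  have : s(x, y) ∈ bridges G := mem_bridges.2 ⟨hxy,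
    singleton_mem_cuts_of_unique hne hxy fun z hz hzG => by
      by_contra hzy
      exact h z hz hzy hzG⟩
  simp [hb] at this

theorem isTriangle_of_bridges_eq_empty (hG : Loopless G) (hb : bridges G = ∅)
    (hcard : G.card = 3) : IsTriangle G := by
  obtain ⟨e, he⟩ : G.Nonempty := Finset.card_pos.1 (by omega)
  induction e with
  | _ a b =>
  have hab : a ≠ b := by simpa using hG _ he
  obtain ⟨v, hva, hvb, hav⟩ := exists_second_edge hG hb he
  obtain ⟨w, hwv, hwa, hvw⟩ := exists_second_edge hG hb (Sym2.eq_swap ▸ hav)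
  obtain ⟨u, hub, hua, hbu⟩ := exists_second_edge hG hb (Sym2.eq_swap ▸ he)
  have hsub : {s(a, b), s(a, v), s(v, w)} ⊆ G := by
    intro f hf
    simp only [Finset.mem_insert, Finset.mem_singleton] at hf
    rcases hf with rfl | rfl | rfl <;> assumption
  have hthree : ({s(a, b), s(a, v), s(v, w)} : Finset (Sym2 (Fin n))).card = 3 := by
    rw [Finset.card_eq_three]
    refine ⟨_, _, _, ?_, ?_, ?_, rfl⟩ <;> simp only [ne_eq, Sym2.eq_iff] <;> grind
  have hEq := Finset.eq_of_subset_of_card_le hsub (by omega)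
  have hwb : w = b := by
    rw [← hEq] at hbu
    simp only [Finset.mem_insert, Finset.mem_singleton, Sym2.eq_iff] at hbu
    grind
  subst hwb
  refine ⟨a, w, v, hab, hva.symm, hwv, ?_⟩
  rw [← hEq, Sym2.eq_swap (a := v)]

/-- A bridgeless graph with an odd number `≥ 5` of edges contains a forest with four edges,
unless it is `K_4^-`. -/
theorem exists_shattered_four (hG : Loopless G) (hb : bridges G = ∅) (hcard : 5 ≤ G.card)
    (hodd : Odd G.card) (hK : ¬ IsK4Minus G) : ∃ T ⊆ G, Shattered T ∧ T.card = 4 := by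
  have hdiag : ∀ {x y : Fin n}, s(x, y) ∈ G → x ≠ y := fun h => by simpa using hG _ h
  obtain ⟨e, he⟩ : G.Nonempty := Finset.card_pos.1 (by omega)
  induction e with
  | _ a b =>
  have hab := hdiag he
  obtain ⟨v, hva, hvb, hav⟩ := exists_second_edge hG hb he
  have hT : Shattered {s(v, a), s(a, b)} :=
    (shattered_singleton (hG _ he)).insert_of_forall_notMem hva (by simp [hva, hvb])
  obtain ⟨w, w', hww, hwa, hwb, hwv⟩ : ∃ w w', s(w, w') ∈ G ∧ w ≠ a ∧ w ≠ b ∧ w ≠ v := by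
    by_contra! h
    have hsub : G ⊆ {s(a, b), s(a, v), s(b, v)} := by
      intro f hf
      induction f with
      | _ i j =>
        have h1 := h i j hf
        have h2 := h j i (Sym2.eq_swap ▸ hf)
        have h3 := hdiag hf
        simp only [Finset.mem_insert, Finset.mem_singleton, Sym2.eq_iff]
        grind
    have := (Finset.card_le_card hsub).trans Finset.card_le_three
    omega
  obtain ⟨w'', hw''w, hw''w', hww'⟩ := exists_second_edge hG hb hww
  have hav' : s(v, a) ∈ G := Sym2.eq_swap ▸ hav
  have hw'w := hdiag hww
  by_cases hout : ∃ u, s(w, u) ∈ G ∧ (u = a ∨ u = b ∨ u = v)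
  · obtain ⟨u, hwu, hu⟩ := hout
    have hT3 : Shattered {s(w, u), s(v, a), s(a, b)} :=
      hT.insert_of_forall_notMem (hdiag hwu) (by simp [hwa, hwb, hwv])
    by_cases hz : ∃ z z', s(z, z') ∈ G ∧ z ≠ a ∧ z ≠ b ∧ z ≠ v ∧ z ≠ w
    · obtain ⟨z, z', hzz, hza, hzb, hzv, hzw⟩ := hz
      refine ⟨{s(z, z'), s(w, u), s(v, a), s(a, b)}, ?_,
        hT3.insert_of_forall_notMem (hdiag hzz) ?_, ?_⟩
      · intro f hf
        simp only [Finset.mem_insert, Finset.mem_singleton] at hf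
        rcases hf with rfl | rfl | rfl | rfl <;> assumption
      · simp only [Finset.mem_insert, Finset.mem_singleton]
        rintro f (rfl | rfl | rfl) <;> rw [Sym2.mem_iff] <;> grind
      · have := hdiag hzz
        rw [Finset.card_insert_of_notMem, Finset.card_insert_of_notMem,
          Finset.card_insert_of_notMem, Finset.card_singleton] <;>
        simp only [Finset.mem_insert, Finset.mem_singleton, Sym2.eq_iff] <;> grind
    · exfalso
      push Not at hz
      have hsub : G ⊆ {s(a, b), s(a, v), s(a, w), s(b, v), s(b, w), s(v, w)} := by
        intro f hf
        induction f with
        | _ i j =>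
          have h1 := hz i j hf
          have h2 := hz j i (Sym2.eq_swap ▸ hf)
          have h3 := hdiag hf
          simp only [Finset.mem_insert, Finset.mem_singleton, Sym2.eq_iff]
          grind
      set K : Finset (Sym2 (Fin n)) := {s(a, b), s(a, v), s(a, w), s(b, v), s(b, w), s(v, w)}
        with hKdef
      have hK6 : K.card ≤ 6 := Finset.card_le_six
      have hle := Finset.card_le_card hsub
      have h5 : G.card = 5 := by
        obtain ⟨t, ht⟩ := hodd
        omega
      have hK6' : K.card = 6 := by
        rw [hKdef, Finset.card_insert_of_notMem, Finset.card_insert_of_notMem,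
          Finset.card_insert_of_notMem, Finset.card_insert_of_notMem,
          Finset.card_insert_of_notMem, Finset.card_singleton] <;>
        simp only [Finset.mem_insert, Finset.mem_singleton, Sym2.eq_iff] <;> grind
      obtain ⟨f, hf⟩ : ∃ f, K \ G = {f} := by
        rw [← Finset.card_eq_one, Finset.card_sdiff_of_subset hsub]
        omega
      have hGK : G = K.erase f := by
        rw [← Finset.sdiff_singleton_eq_erase, ← hf, Finset.sdiff_sdiff_eq_self hsub]
      have hfK : f ∈ K := (Finset.mem_sdiff.1 (hf ▸ Finset.mem_singleton_self f)).1
      have hab' := hab.symm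
      apply hK
      have main : ∀ x y z t : Fin n, x ≠ y → x ≠ z → x ≠ t → y ≠ z → y ≠ t → z ≠ t →
          f = s(y, t) → K = {s(x, y), s(x, z), s(x, t), s(y, z), s(z, t), s(y, t)} →
          IsK4Minus G := by
        intro x y z t h1 h2 h3 h4 h5 h6 hfe hKe
        refine ⟨x, y, z, t, h1, h2, h3, h4, h5, h6, ?_⟩
        rw [hGK, hKe, hfe]
        ext g
        simp only [Finset.mem_erase, Finset.mem_insert, Finset.mem_singleton]
        have d1 : s(x, y) ≠ s(y, t) := by rw [ne_eq, Sym2.eq_iff]; grind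
        have d2 : s(x, z) ≠ s(y, t) := by rw [ne_eq, Sym2.eq_iff]; grind
        have d3 : s(x, t) ≠ s(y, t) := by rw [ne_eq, Sym2.eq_iff]; grind
        have d4 : s(y, z) ≠ s(y, t) := by rw [ne_eq, Sym2.eq_iff]; grind
        have d5 : s(z, t) ≠ s(y, t) := by rw [ne_eq, Sym2.eq_iff]; grind
        grind
      have perm : ∀ x y z t : Fin n, f = s(y, t) →
          s(x, y) ∈ K → s(x, z) ∈ K → s(x, t) ∈ K → s(y, z) ∈ K → s(z, t) ∈ K → s(y, t) ∈ K →
          x ≠ y → x ≠ z → x ≠ t → y ≠ z → y ≠ t → z ≠ t → IsK4Minus G := by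
        intro x y z t hfe k1 k2 k3 k4 k5 k6 h1 h2 h3 h4 h5 h6
        refine main x y z t h1 h2 h3 h4 h5 h6 hfe (Finset.eq_of_subset_of_card_le ?_ ?_).symm
        · intro g hg
          simp only [Finset.mem_insert, Finset.mem_singleton] at hg
          rcases hg with rfl | rfl | rfl | rfl | rfl | rfl <;> assumption
        · rw [hK6', Finset.card_insert_of_notMem, Finset.card_insert_of_notMem,
            Finset.card_insert_of_notMem, Finset.card_insert_of_notMem,
            Finset.card_insert_of_notMem, Finset.card_singleton] <;>
          simp only [Finset.mem_insert, Finset.mem_singleton, Sym2.eq_iff] <;> grind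
      simp only [hKdef, Finset.mem_insert, Finset.mem_singleton] at hfK
      rcases hfK with h | h | h | h | h | h
      · apply perm v a w b h <;>
          first | assumption | (symm; assumption) | simp [hKdef, Sym2.eq_swap]
      · apply perm b a w v h <;>
          first | assumption | (symm; assumption) | simp [hKdef, Sym2.eq_swap]
      · apply perm b a v w h <;>
          first | assumption | (symm; assumption) | simp [hKdef, Sym2.eq_swap]
      · apply perm a b w v h <;>
          first | assumption | (symm; assumption) | simp [hKdef, Sym2.eq_swap]
      · apply perm a b v w h <;>
          first | assumption | (symm; assumption) | simp [hKdef]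
      · apply perm a v b w h <;>
          first | assumption | (symm; assumption) | simp [hKdef, Sym2.eq_swap]
  · push Not at hout
    have h1 := hout w' hww
    have h2 := hout w'' hww'
    have hT3 : Shattered {s(w, w'), s(v, a), s(a, b)} :=
      hT.insert_of_forall_notMem hw'w (by simp [hwa, hwb, hwv])
    refine ⟨{s(w'', w), s(w, w'), s(v, a), s(a, b)}, ?_,
      hT3.insert_of_forall_notMem hw''w ?_, ?_⟩
    · intro f hf
      rw [Sym2.eq_swap] at hww'
      simp only [Finset.mem_insert, Finset.mem_singleton] at hf
      rcases hf with rfl | rfl | rfl | rfl <;> assumption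
    · simp only [Finset.mem_insert, Finset.mem_singleton]
      rintro f (rfl | rfl | rfl) <;> rw [Sym2.mem_iff] <;> grind
    · rw [Finset.card_insert_of_notMem, Finset.card_insert_of_notMem,
        Finset.card_insert_of_notMem, Finset.card_singleton] <;>
      simp only [Finset.mem_insert, Finset.mem_singleton, Sym2.eq_iff] <;> grind

/-- The ratio `p / (1 - p)`. -/
noncomputable def skewRatio (p : ℝ) : ℝ := p / (1 - p)

/-- The coefficient of `q_1`. -/
noncomputable def coeffOne (p : ℝ) : ℝ := (p ^ 2 - p - 1) / (p ^ 2 + p + 1)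

/-- The coefficient of `q_2`. -/
noncomputable def coeffTwo (p : ℝ) : ℝ := (p ^ 2 - 3 * p + 1) / (p ^ 2 + p + 1)

/-- The coefficient of `q_3`. -/
noncomputable def coeffThree (p : ℝ) : ℝ :=
  (5 * p ^ 2 - 27 * p + 45 - 28 / p + 6 / p ^ 2) / (4 * (p ^ 2 + p + 1))

/-- The extremal eigenvalue. -/
noncomputable def extremal (p : ℝ) : ℝ := -(p ^ 3) / (1 - p ^ 3)

/-- The combination of cut probabilities in `lamP`. -/
noncomputable def cutWeight (p : ℝ) (G : Finset (Sym2 (Fin n))) : ℝ :=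
  qk n 0 G + coeffOne p * qk n 1 G + coeffTwo p * qk n 2 G + coeffThree p * qk n 3 G

theorem lamP_eq (p : ℝ) (G : Finset (Sym2 (Fin n))) :
    lamP n p G = (-skewRatio p) ^ G.card * cutWeight p G := rfl

section Analysis

variable {p : ℝ}

theorem extremal_eq (p : ℝ) : extremal p = -(p ^ 3) / ((1 - p) * (p ^ 2 + p + 1)) := by
  unfold extremal
  congr 1
  ring

theorem skewRatio_pos (h0 : 31 / 125 ≤ p) (h1 : p < 1 / 2) : 0 < skewRatio p :=
  div_pos (by linarith) (by linarith)

theorem skewRatio_le_one (h1 : p < 1 / 2) : skewRatio p ≤ 1 :=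
  (div_le_one (by linarith)).2 (by linarith)

theorem neg_one_le_coeffOne (p : ℝ) : -1 ≤ coeffOne p := by
  rw [coeffOne, le_div_iff₀ (by nlinarith [sq_nonneg (p + 1 / 2)])]
  nlinarith [sq_nonneg p]

theorem coeffOne_le (h0 : 31 / 125 ≤ p) (h1 : p < 1 / 2) : coeffOne p ≤ -(5 / 7) := by
  rw [coeffOne, div_le_iff₀ (by positivity)]
  nlinarith

theorem bernstein_term_nonneg (h0 : 31 / 125 ≤ p) (h1 : p < 1 / 2) (i j : ℕ) :
    0 ≤ (p - 31 / 125) ^ i * (1 / 2 - p) ^ j :=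
  mul_nonneg (pow_nonneg (by linarith) i) (pow_nonneg (by linarith) j)

theorem coeffThree_nonneg (h0 : 31 / 125 ≤ p) (h1 : p < 1 / 2) : 0 ≤ coeffThree p := by
  have hp : 0 < p := by linarith
  have b := bernstein_term_nonneg h0 h1
  have key : coeffThree p =
      (5 * p ^ 4 - 27 * p ^ 3 + 45 * p ^ 2 - 28 * p + 6) / (4 * p ^ 2 * (p ^ 2 + p + 1)) := by
    unfold coeffThree
    field_simp
  rw [key]
  refine div_nonneg ?_ (by positivity)
  linarith [b 0 4, b 1 3, b 2 2, b 3 1, b 4 0]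

theorem extremal_add_le_zero (h0 : 31 / 125 ≤ p) (h1 : p < 1 / 2) :
    extremal p + 1 / 100000 ≤ 0 := by
  have hp : 0 < p := by linarith
  have hq : 0 < 1 - p := by linarith
  have b := bernstein_term_nonneg h0 h1
  have key : 0 - extremal p - 1 / 100000 =
      (p ^ 3 - 1 / 100000 * ((1 - p) * (p ^ 2 + p + 1))) / ((1 - p) ^ 1 * (p ^ 2 + p + 1)) := by
    rw [extremal_eq]
    field_simp
    ring
  rw [← sub_nonneg, ← sub_sub, key]
  refine div_nonneg ?_ (by positivity)
  linarith [b 0 3, b 1 2, b 2 1, b 3 0]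

theorem extremal_add_le_coeffTwo (h0 : 31 / 125 ≤ p) (h1 : p < 1 / 2) :
    extremal p + 1 / 100000 ≤ skewRatio p ^ 4 * (3 / 4 * coeffTwo p) := by
  have hp : 0 < p := by linarith
  have hq : 0 < 1 - p := by linarith
  have b := bernstein_term_nonneg h0 h1
  have key : skewRatio p ^ 4 * (3 / 4 * coeffTwo p) - extremal p - 1 / 100000 =
      (3 / 4 * p ^ 4 * (p ^ 2 - 3 * p + 1) + p ^ 3 * (1 - p) ^ 3 - 1 / 100000 * ((1 - p) ^ 4 * (p ^ 2 + p + 1))) / ((1 - p) ^ 4 * (p ^ 2 + p + 1)) := by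
    rw [extremal_eq]
    unfold skewRatio coeffTwo
    field_simp
    ring
  rw [← sub_nonneg, ← sub_sub, key]
  refine div_nonneg ?_ (by positivity)
  linarith [b 0 6, b 1 5, b 2 4, b 3 3, b 4 2, b 5 1, b 6 0]

theorem extremal_add_le_six_bridges (h0 : 31 / 125 ≤ p) (h1 : p < 1 / 2) :
    extremal p + 1 / 100000 ≤ skewRatio p ^ 6 * ((1 + 6 * coeffOne p) / 64) := by
  have hp : 0 < p := by linarith
  have hq : 0 < 1 - p := by linarith
  have b := bernstein_term_nonneg h0 h1
  have key : skewRatio p ^ 6 * ((1 + 6 * coeffOne p) / 64) - extremal p - 1 / 100000 =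
      (p ^ 6 * ((p ^ 2 + p + 1) + 6 * (p ^ 2 - p - 1)) / 64 + p ^ 3 * (1 - p) ^ 5 - 1 / 100000 * ((1 - p) ^ 6 * (p ^ 2 + p + 1))) / ((1 - p) ^ 6 * (p ^ 2 + p + 1)) := by
    rw [extremal_eq]
    unfold skewRatio coeffOne
    field_simp
    ring
  rw [← sub_nonneg, ← sub_sub, key]
  refine div_nonneg ?_ (by positivity)
  linarith [b 0 8, b 1 7, b 2 6, b 3 5, b 4 4, b 5 3, b 6 2, b 7 1, b 8 0]

theorem extremal_add_le_six_bridges_coeffTwo (h0 : 31 / 125 ≤ p) (h1 : p < 1 / 2) :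
    extremal p + 1 / 100000 ≤ skewRatio p ^ 6 * ((1 + 6 * coeffOne p) / 64 + 1 / 2 * coeffTwo p) := by
  have hp : 0 < p := by linarith
  have hq : 0 < 1 - p := by linarith
  have b := bernstein_term_nonneg h0 h1
  have key : skewRatio p ^ 6 * ((1 + 6 * coeffOne p) / 64 + 1 / 2 * coeffTwo p) - extremal p - 1 / 100000 =
      (p ^ 6 * ((p ^ 2 + p + 1) + 6 * (p ^ 2 - p - 1)) / 64 + 1 / 2 * p ^ 6 * (p ^ 2 - 3 * p + 1) + p ^ 3 * (1 - p) ^ 5 -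
        1 / 100000 * ((1 - p) ^ 6 * (p ^ 2 + p + 1))) / ((1 - p) ^ 6 * (p ^ 2 + p + 1)) := by
    rw [extremal_eq]
    unfold skewRatio coeffOne coeffTwo
    field_simp
    ring
  rw [← sub_nonneg, ← sub_sub, key]
  refine div_nonneg ?_ (by positivity)
  linarith [b 0 8, b 1 7, b 2 6, b 3 5, b 4 4, b 5 3, b 6 2, b 7 1, b 8 0]

theorem extremal_add_le_three_forest (h0 : 31 / 125 ≤ p) (h1 : p < 1 / 2) :
    extremal p + 1 / 100000 ≤ -(skewRatio p ^ 3 * ((1 + 3 * coeffOne p + 3 * coeffTwo p + coeffThree p) / 8)) := by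
  have hp : 0 < p := by linarith
  have hq : 0 < 1 - p := by linarith
  have b := bernstein_term_nonneg h0 h1
  have key : -(skewRatio p ^ 3 * ((1 + 3 * coeffOne p + 3 * coeffTwo p + coeffThree p) / 8)) - extremal p - 1 / 100000 =
      (-(p ^ 3 * ((p ^ 2 + p + 1) + 3 * (p ^ 2 - p - 1) + 3 * (p ^ 2 - 3 * p + 1)) / 8) - p * (5 * p ^ 4 - 27 * p ^ 3 + 45 * p ^ 2 - 28 * p + 6) / 32 +
        p ^ 3 * (1 - p) ^ 2 - 1 / 100000 * ((1 - p) ^ 3 * (p ^ 2 + p + 1))) / ((1 - p) ^ 3 * (p ^ 2 + p + 1)) := by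
    rw [extremal_eq]
    unfold skewRatio coeffOne coeffTwo coeffThree
    field_simp
    ring
  rw [← sub_nonneg, ← sub_sub, key]
  refine div_nonneg ?_ (by positivity)
  linarith [b 0 5, b 1 4, b 2 3, b 3 2, b 4 1, b 5 0]

theorem extremal_add_le_odd (h0 : 31 / 125 ≤ p) (h1 : p < 1 / 2) :
    extremal p + 1 / 100000 ≤ -(skewRatio p ^ 5 * (1 / 16 + coeffThree p / 2)) := by
  have hp : 0 < p := by linarith
  have hq : 0 < 1 - p := by linarith
  have b := bernstein_term_nonneg h0 h1
  have key : -(skewRatio p ^ 5 * (1 / 16 + coeffThree p / 2)) - extremal p - 1 / 100000 =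
      (-(p ^ 5 * (p ^ 2 + p + 1) / 16) - p ^ 3 * (5 * p ^ 4 - 27 * p ^ 3 + 45 * p ^ 2 - 28 * p + 6) / 8 +
        p ^ 3 * (1 - p) ^ 4 - 1 / 100000 * ((1 - p) ^ 5 * (p ^ 2 + p + 1))) / ((1 - p) ^ 5 * (p ^ 2 + p + 1)) := by
    rw [extremal_eq]
    unfold skewRatio coeffThree
    field_simp
    ring
  rw [← sub_nonneg, ← sub_sub, key]
  refine div_nonneg ?_ (by positivity)
  linarith [b 0 7, b 1 6, b 2 5, b 3 4, b 4 3, b 5 2, b 6 1, b 7 0]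

theorem extremal_add_le_odd_coeffTwo (h0 : 31 / 125 ≤ p) (h1 : p < 1 / 2) :
    extremal p + 1 / 100000 ≤ -(skewRatio p ^ 5 * (1 / 16 + 3 / 4 * coeffTwo p + coeffThree p / 2)) := by
  have hp : 0 < p := by linarith
  have hq : 0 < 1 - p := by linarith
  have b := bernstein_term_nonneg h0 h1
  have key : -(skewRatio p ^ 5 * (1 / 16 + 3 / 4 * coeffTwo p + coeffThree p / 2)) - extremal p - 1 / 100000 =
      (-(p ^ 5 * (p ^ 2 + p + 1) / 16) - 3 / 4 * p ^ 5 * (p ^ 2 - 3 * p + 1) -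
        p ^ 3 * (5 * p ^ 4 - 27 * p ^ 3 + 45 * p ^ 2 - 28 * p + 6) / 8 +
        p ^ 3 * (1 - p) ^ 4 - 1 / 100000 * ((1 - p) ^ 5 * (p ^ 2 + p + 1))) / ((1 - p) ^ 5 * (p ^ 2 + p + 1)) := by
    rw [extremal_eq]
    unfold skewRatio coeffTwo coeffThree
    field_simp
    ring
  rw [← sub_nonneg, ← sub_sub, key]
  refine div_nonneg ?_ (by positivity)
  linarith [b 0 7, b 1 6, b 2 5, b 3 4, b 4 3, b 5 2, b 6 1, b 7 0]

theorem extremal_lt_four_forest (h0 : 31 / 125 ≤ p) (h1 : p < 1 / 2) :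
    extremal p < skewRatio p ^ 4 * ((1 + 4 * coeffOne p + 6 * coeffTwo p + 4 * coeffThree p) / 16) := by
  have hp : 0 < p := by linarith
  have hq : 0 < 1 - p := by linarith
  have key : skewRatio p ^ 4 * ((1 + 4 * coeffOne p + 6 * coeffTwo p + 4 * coeffThree p) / 16) - extremal p =
      (3 / 8 * p ^ 2 * (1 - 2 * p)) / ((1 - p) ^ 4 * (p ^ 2 + p + 1)) := by
    rw [extremal_eq]
    unfold skewRatio coeffOne coeffTwo coeffThree
    field_simp
    ring
  have hr : 0 < 1 - 2 * p := by linarith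
  rw [← sub_pos, key]
  positivity

theorem extremal_lt_k4Minus (h0 : 31 / 125 ≤ p) (h1 : p < 1 / 2) :
    extremal p < -(skewRatio p ^ 5 * (1 / 8 + coeffTwo p / 4 + coeffThree p / 2)) := by
  have hp : 0 < p := by linarith
  have hq : 0 < 1 - p := by linarith
  have key : -(skewRatio p ^ 5 * (1 / 8 + coeffTwo p / 4 + coeffThree p / 2)) - extremal p =
      (1 / 4 * p ^ 3 * (1 - 2 * p)) / ((1 - p) ^ 5 * (p ^ 2 + p + 1)) := by
    rw [extremal_eq]
    unfold skewRatio coeffTwo coeffThree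
    field_simp
    ring
  have hr : 0 < 1 - 2 * p := by linarith
  rw [← sub_pos, key]
  positivity

theorem extremal_lt_k4Minus_coeffTwo (h0 : 31 / 125 ≤ p) (h1 : p < 1 / 2) :
    extremal p < -(skewRatio p ^ 5 * (1 / 8 + coeffTwo p / 2 + coeffThree p / 2)) := by
  have hp : 0 < p := by linarith
  have hq : 0 < 1 - p := by linarith
  have key : -(skewRatio p ^ 5 * (1 / 8 + coeffTwo p / 2 + coeffThree p / 2)) - extremal p =
      (p ^ 3 * ((1 - 2 * p) * (1 - p ^ 2 + p ^ 3) + p ^ 4) / 4) / ((1 - p) ^ 5 * (p ^ 2 + p + 1)) := by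
    rw [extremal_eq]
    unfold skewRatio coeffTwo coeffThree
    field_simp
    ring
  have hr : 0 < 1 - 2 * p := by linarith
  have hs : 0 < 1 - p ^ 2 := by nlinarith
  rw [← sub_pos, key]
  positivity

theorem one_edge_value (h0 : 31 / 125 ≤ p) (h1 : p < 1 / 2) :
    -skewRatio p * (1 / 2 + coeffOne p * (1 / 2)) = extremal p := by
  have hq : 1 - p ≠ 0 := by linarith
  have hp : 0 < p := by linarith
  rw [extremal_eq]
  unfold skewRatio coeffOne
  field_simp
  ring

theorem two_edges_value (h0 : 31 / 125 ≤ p) (h1 : p < 1 / 2) :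
    (-skewRatio p) ^ 2 * (1 / 4 + coeffOne p * (2 / 4) + coeffTwo p * (1 / 4)) = extremal p := by
  have hq : 1 - p ≠ 0 := by linarith
  have hp : 0 < p := by linarith
  rw [extremal_eq]
  unfold skewRatio coeffOne coeffTwo
  field_simp
  ring

theorem triangle_value (h0 : 31 / 125 ≤ p) (h1 : p < 1 / 2) :
    (-skewRatio p) ^ 3 * (1 / 4 + coeffTwo p * (3 / 4)) = extremal p := by
  have hq : 1 - p ≠ 0 := by linarith
  have hp : 0 < p := by linarith
  rw [extremal_eq]
  unfold skewRatio coeffTwo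
  field_simp
  ring

end Analysis

theorem Shattered.cutWeight_eq (h : Shattered G) (p : ℝ) :
    cutWeight p G = 1 / 2 ^ G.card + coeffOne p * (G.card / 2 ^ G.card) +
      coeffTwo p * (G.card.choose 2 / 2 ^ G.card) +
      coeffThree p * (G.card.choose 3 / 2 ^ G.card) := by
  simp only [cutWeight, h.qk_eq, Nat.choose_zero_right, Nat.choose_one_right, Nat.cast_one]

theorem cutWeight_eq_bridges (p : ℝ) (G : Finset (Sym2 (Fin n))) :
    cutWeight p G = (1 + coeffOne p * (bridges G).card) * qk n 0 G + coeffTwo p * qk n 2 G +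
      coeffThree p * qk n 3 G := by
  rw [cutWeight, qk_one_eq]
  ring

theorem le_lamP_of_even {p F : ℝ} {k : ℕ} (h0 : 31 / 125 ≤ p) (h1 : p < 1 / 2)
    (hG : Even G.card) (hk : k ≤ G.card) (hF : F ≤ 0) (h : F ≤ cutWeight p G) :
    skewRatio p ^ k * F ≤ lamP n p G := by
  have hr := skewRatio_pos h0 h1
  rw [lamP_eq, hG.neg_pow]
  calc skewRatio p ^ k * F ≤ skewRatio p ^ G.card * F :=
        mul_le_mul_of_nonpos_right (pow_le_pow_of_le_one hr.le (skewRatio_le_one h1) hk) hF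
    _ ≤ _ := mul_le_mul_of_nonneg_left h (by positivity)

theorem le_lamP_of_odd {p F : ℝ} {k : ℕ} (h0 : 31 / 125 ≤ p) (h1 : p < 1 / 2)
    (hG : Odd G.card) (hk : k ≤ G.card) (hF : 0 ≤ F) (h : cutWeight p G ≤ F) :
    -(skewRatio p ^ k * F) ≤ lamP n p G := by
  have hr := skewRatio_pos h0 h1
  rw [lamP_eq, hG.neg_pow, neg_mul, neg_le_neg_iff]
  calc skewRatio p ^ G.card * cutWeight p G ≤ skewRatio p ^ G.card * F :=
        mul_le_mul_of_nonneg_left h (by positivity)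
    _ ≤ _ := mul_le_mul_of_nonneg_right
        (pow_le_pow_of_le_one hr.le (skewRatio_le_one h1) hk) hF

theorem lamP_empty (p : ℝ) : lamP n p ∅ = 1 := by
  rw [lamP_eq, shattered_empty.cutWeight_eq]
  simp

theorem lamP_of_card_one {p : ℝ} (h0 : 31 / 125 ≤ p) (h1 : p < 1 / 2) (hG : Loopless G)
    (hc : G.card = 1) : lamP n p G = extremal p := by
  rw [lamP_eq, (shattered_of_card_le hG (by omega)).cutWeight_eq, hc, ← one_edge_value h0 h1]
  norm_num [Nat.choose]

theorem lamP_of_card_two {p : ℝ} (h0 : 31 / 125 ≤ p) (h1 : p < 1 / 2) (hG : Loopless G)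
    (hc : G.card = 2) : lamP n p G = extremal p := by
  rw [lamP_eq, (shattered_of_card_le hG (by omega)).cutWeight_eq, hc, ← two_edges_value h0 h1]
  norm_num [Nat.choose]

theorem lamP_of_isTriangle {p : ℝ} (h0 : 31 / 125 ≤ p) (h1 : p < 1 / 2) (hG : Loopless G)
    (hT : IsTriangle G) : lamP n p G = extremal p := by
  obtain ⟨a, b, c, hab, hac, hbc, rfl⟩ := hT
  set T : Finset (Sym2 (Fin n)) := {s(a, b), s(a, c), s(b, c)} with hTdef
  have e1 : s(a, b) ≠ s(a, c) := by rw [ne_eq, Sym2.eq_iff]; grind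
  have e2 : s(a, b) ≠ s(b, c) := by rw [ne_eq, Sym2.eq_iff]; grind
  have e3 : s(a, c) ≠ s(b, c) := by rw [ne_eq, Sym2.eq_iff]; grind
  have hcard : T.card = 3 := Finset.card_eq_three.2 ⟨_, _, _, e1, e2, e3, rfl⟩
  have hcut : ∀ A ∈ cuts T, A.card = 0 ∨ A.card = 2 := by
    intro A hA
    obtain ⟨f, rfl⟩ := mem_cuts.1 hA
    simp only [hTdef, cutOf, Finset.filter_insert, Finset.filter_singleton, Sym2.lift_mk]
    rcases Bool.eq_false_or_eq_true (f a) with h1 | h1 <;>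
      rcases Bool.eq_false_or_eq_true (f b) with h2 | h2 <;>
      rcases Bool.eq_false_or_eq_true (f c) with h3 | h3 <;>
      simp [h1, h2, h3, e1, e2, e3]
  have hodd : ∀ k, k ≠ 0 → k ≠ 2 → qk n k T = 0 := by
    intro k hk0 hk2
    rw [qk_eq_div, Finset.filter_eq_empty_iff.2 (by grind)]
    simp
  have hsum : qk n 0 T + qk n 2 T = 1 := by
    have hpos := card_cuts_pos T
    rw [qk_eq_div, qk_eq_div, ← add_div, div_eq_one_iff_eq (by positivity)]
    norm_cast
    rw [← Finset.card_union_of_disjoint, ← Finset.filter_or, Finset.filter_true_of_mem hcut]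
    exact Finset.disjoint_filter.2 fun A _ h h' => by omega
  have hzero : qk n 0 T ≤ 1 / 4 := by
    have h := (shattered_pair (hG s(a, b) (by simp [hTdef])) (hG s(a, c) (by simp [hTdef]))
      e1).qk_zero_le (G := T) (by simp [hTdef, Finset.insert_subset_iff])
    rw [Finset.card_pair e1] at h
    linarith
  have htwo := qk_le_three_quarters hG (Finset.card_pos.1 (by omega)) 2
  have hz : qk n 0 T = 1 / 4 := by linarith
  have ht : qk n 2 T = 3 / 4 := by linarith
  rw [lamP_eq, cutWeight, hodd 1 (by simp) (by simp), hodd 3 (by simp) (by simp), hz, ht, hcard,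
    ← triangle_value h0 h1]
  ring

theorem extremal_lt_lamP_of_shattered_four {p : ℝ} (h0 : 31 / 125 ≤ p) (h1 : p < 1 / 2)
    (hS : Shattered G) (hc : G.card = 4) : extremal p < lamP n p G := by
  refine (extremal_lt_four_forest h0 h1).trans_le (le_of_eq ?_)
  rw [lamP_eq, hS.cutWeight_eq, hc, show Nat.choose 4 2 = 6 from rfl,
    show Nat.choose 4 3 = 4 from rfl]
  push_cast
  ring

theorem extremal_lt_lamP_of_isK4Minus {p : ℝ} (h0 : 31 / 125 ≤ p) (h1 : p < 1 / 2)
    (hK : IsK4Minus G) : extremal p < lamP n p G := by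
  obtain ⟨a, b, c, d, hab, hac, had, hbc, hbd, hcd, hGdef⟩ := hK
  have hcard : G.card = 5 := by
    rw [hGdef, Finset.card_insert_of_notMem, Finset.card_insert_of_notMem,
      Finset.card_insert_of_notMem, Finset.card_insert_of_notMem, Finset.card_singleton] <;>
    simp only [Finset.mem_insert, Finset.mem_singleton, Sym2.eq_iff] <;> grind
  have hzero : qk n 0 G ≤ 1 / 8 := by
    have hS : Shattered {s(d, a), s(c, a), s(a, b)} := by
      refine Shattered.insert_of_forall_notMem
        (Shattered.insert_of_forall_notMem (shattered_singleton (by simpa using hab)) hac.symm ?_)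
        had.symm ?_ <;> simp <;> grind
    have h := hS.qk_zero_le (G := G) (by
      rw [hGdef]
      simp [Finset.insert_subset_iff, Sym2.eq_swap])
    rw [Finset.card_insert_of_notMem, Finset.card_pair] at h
    · norm_num at h ⊢
      exact h
    · rw [ne_eq, Sym2.eq_iff]; grind
    · simp only [Finset.mem_insert, Finset.mem_singleton, Sym2.eq_iff]; grind
  have htwo : 2 * qk n 0 G ≤ qk n 2 G := by
    have hb : {s(a, b), s(b, c)} ∈ (cuts G).filter fun A => A.card = 2 := by
      refine Finset.mem_filter.2 ⟨mem_cuts.2 ⟨fun v => decide (v = b), ?_⟩, Finset.card_pair ?_⟩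
      · simp only [hGdef, cutOf, Finset.filter_insert, Finset.filter_singleton, Sym2.lift_mk]
        simp [hab, hbc.symm, hbd.symm]
      · rw [ne_eq, Sym2.eq_iff]; grind
    have hd : {s(a, d), s(c, d)} ∈ (cuts G).filter fun A => A.card = 2 := by
      refine Finset.mem_filter.2 ⟨mem_cuts.2 ⟨fun v => decide (v = d), ?_⟩, Finset.card_pair ?_⟩
      · simp only [hGdef, cutOf, Finset.filter_insert, Finset.filter_singleton, Sym2.lift_mk]
        simp [had, hbd, hcd]
      · rw [ne_eq, Sym2.eq_iff]; grind
    have hne : ({s(a, b), s(b, c)} : Finset (Sym2 (Fin n))) ≠ {s(a, d), s(c, d)} := by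
      intro h
      have : s(a, b) ∈ ({s(a, d), s(c, d)} : Finset (Sym2 (Fin n))) := by rw [← h]; simp
      simp only [Finset.mem_insert, Finset.mem_singleton, Sym2.eq_iff] at this
      grind
    have h2 : 2 ≤ ((cuts G).filter fun A => A.card = 2).card := by
      exact (Finset.card_pair hne).ge.trans (Finset.card_le_card (by
        simp only [Finset.insert_subset_iff, hb, true_and, Finset.singleton_subset_iff, hd]))
    rw [qk_eq 2]
    exact mul_le_mul_of_nonneg_right (by exact_mod_cast h2) (qk_nonneg 0 G)
  have hodd : Odd G.card := by rw [hcard]; decide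
  have htwo' : qk n 2 G ≤ 1 / 2 := by
    refine qk_two_le_half (A := {s(a, b), s(a, c), s(a, d)})
      (mem_cuts.2 ⟨fun v => decide (v = a), ?_⟩) ?_
    · simp only [hGdef, cutOf, Finset.filter_insert, Finset.filter_singleton, Sym2.lift_mk]
      simp [hab.symm, hac.symm, had.symm]
    · rw [Finset.card_eq_three.2 ⟨s(a, b), s(a, c), s(a, d), ?_, ?_, ?_, rfl⟩]
      · decide
      all_goals rw [ne_eq, Sym2.eq_iff]; grind
  have hthree := mul_le_mul_of_nonneg_left (qk_three_le_half G) (coeffThree_nonneg h0 h1)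
  have hc1 := coeffOne_le h0 h1
  have h3 := coeffThree_nonneg h0 h1
  have hone : coeffOne p * qk n 1 G ≤ 0 :=
    mul_nonpos_of_nonpos_of_nonneg (by linarith) (qk_nonneg 1 G)
  obtain hc2 | hc2 := le_total 0 (coeffTwo p)
  · refine (extremal_lt_k4Minus_coeffTwo h0 h1).trans_le
      (le_lamP_of_odd h0 h1 hodd hcard.ge (by positivity) ?_)
    have := mul_le_mul_of_nonneg_left htwo' hc2
    rw [cutWeight]
    linarith
  · have hlow : -1 ≤ 2 * coeffTwo p := by
      rw [coeffTwo, mul_div_assoc', le_div_iff₀ (by positivity)]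
      nlinarith
    refine (extremal_lt_k4Minus h0 h1).trans_le
      (le_lamP_of_odd h0 h1 hodd hcard.ge (by linarith) ?_)
    have e1 := mul_le_mul_of_nonpos_left htwo hc2
    have e2 := mul_le_mul_of_nonneg_left hzero (show 0 ≤ 1 + 2 * coeffTwo p by linarith)
    rw [cutWeight]
    linarith

theorem bridges_term_lower_bound {p : ℝ} (h0 : 31 / 125 ≤ p) (h1 : p < 1 / 2)
    (hG : Loopless G) (hc : 6 ≤ G.card) (hm : 2 ≤ (bridges G).card) :
    (1 + 6 * coeffOne p) / 64 ≤ (1 + coeffOne p * (bridges G).card) * qk n 0 G := by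
  have hlo := neg_one_le_coeffOne p
  have hhi := coeffOne_le h0 h1
  have hle := Finset.card_le_card (bridges_subset G)
  have b0 := qk_zero_le_of_card (j := 0) hG (by omega) (by omega)
  have b1 := qk_zero_le_of_card (j := 1) hG (by omega)
  have b2 := qk_zero_le_of_card (j := 2) hG (by omega)
  generalize (bridges G).card = m at *
  have step : ∀ q : ℝ, qk n 0 G ≤ q → (1 + coeffOne p * m) * q ≤
      (1 + coeffOne p * m) * qk n 0 G := by
    intro q hq
    refine mul_le_mul_of_nonpos_left hq ?_
    have : (2 : ℝ) ≤ m := by exact_mod_cast hm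
    nlinarith
  obtain hm6 | hm6 := lt_or_ge m 6
  · interval_cases m
    · have := step _ (b2 (by omega))
      norm_num at this ⊢
      linarith
    · have := step _ (b2 (by omega))
      norm_num at this ⊢
      linarith
    · have := step _ (b2 (by omega))
      norm_num at this ⊢
      linarith
    · have := step _ (b1 (by omega))
      norm_num at this ⊢
      linarith
  · refine le_trans ?_ (step _ b0)
    obtain ⟨t, rfl⟩ := Nat.exists_eq_add_of_le hm6
    have ht : (1 : ℝ) + t ≤ 2 ^ t := by
      have : t + 1 ≤ 2 ^ t := Nat.lt_two_pow_self
      have : ((t + 1 : ℕ) : ℝ) ≤ ((2 ^ t : ℕ) : ℝ) := Nat.cast_le.2 this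
      push_cast at this
      linarith
    have ht0 : (0 : ℝ) ≤ t := t.cast_nonneg
    rw [mul_one_div, add_zero, div_le_div_iff₀ (by norm_num) (by positivity), pow_add]
    push_cast
    have e1 := mul_le_mul_of_nonpos_left ht (show 1 + 6 * coeffOne p ≤ 0 by linarith)
    have e2 := mul_nonneg ht0 (show 0 ≤ -1 - 5 * coeffOne p by linarith)
    nlinarith

theorem gap_of_even {p : ℝ} (h0 : 31 / 125 ≤ p) (h1 : p < 1 / 2) (hG : Loopless G)
    (hc : 4 ≤ G.card) (heven : Even G.card) (hS : ¬ (Shattered G ∧ G.card = 4)) :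
    extremal p + 1 / 100000 ≤ lamP n p G := by
  have hc1 := coeffOne_le h0 h1
  have hthree := mul_nonneg (coeffThree_nonneg h0 h1) (qk_nonneg 3 G)
  have hq0 := qk_zero_pos G
  have hq2 := qk_nonneg 2 G
  obtain hm | hm := le_or_gt (bridges G).card 1
  · have hbr : 0 ≤ (1 + coeffOne p * (bridges G).card) * qk n 0 G := by
      have hm' : ((bridges G).card : ℝ) ≤ 1 := by exact_mod_cast hm
      have := neg_one_le_coeffOne p
      refine mul_nonneg ?_ hq0.le
      nlinarith
    obtain hc2 | hc2 := le_total 0 (coeffTwo p)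
    · refine (extremal_add_le_zero h0 h1).trans ?_
      have := le_lamP_of_even (F := 0) h0 h1 heven hc le_rfl (by
        rw [cutWeight_eq_bridges]
        have := mul_nonneg hc2 hq2
        linarith)
      simpa using this
    · refine (extremal_add_le_coeffTwo h0 h1).trans
        (le_lamP_of_even h0 h1 heven hc (by linarith) ?_)
      have := mul_le_mul_of_nonpos_left
        (qk_le_three_quarters hG (Finset.card_pos.1 (by omega)) 2) hc2
      rw [cutWeight_eq_bridges]
      linarith
  · have hc6 : 6 ≤ G.card := by
      by_contra hlt
      have h4 : G.card = 4 := by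
        obtain ⟨t, ht⟩ := heven
        omega
      exact hS ⟨shattered_of_card_le hG (by omega), h4⟩
    have hbr := bridges_term_lower_bound h0 h1 hG hc6 hm
    obtain hc2 | hc2 := le_total 0 (coeffTwo p)
    · refine (extremal_add_le_six_bridges h0 h1).trans
        (le_lamP_of_even h0 h1 heven hc6 (by linarith) ?_)
      have := mul_nonneg hc2 hq2
      rw [cutWeight_eq_bridges]
      linarith
    · refine (extremal_add_le_six_bridges_coeffTwo h0 h1).trans
        (le_lamP_of_even h0 h1 heven hc6 (by linarith) ?_)
      obtain ⟨e, he⟩ := Finset.card_pos.1 (show 0 < (bridges G).card by omega)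
      have := mul_le_mul_of_nonpos_left
        (qk_two_le_half (mem_bridges.1 he).2 (by simp)) hc2
      rw [cutWeight_eq_bridges]
      linarith

theorem gap_of_odd {p : ℝ} (h0 : 31 / 125 ≤ p) (h1 : p < 1 / 2) (hG : Loopless G)
    (hc : 5 ≤ G.card) (hodd : Odd G.card) (hK : ¬ IsK4Minus G) :
    extremal p + 1 / 100000 ≤ lamP n p G := by
  have hlo := neg_one_le_coeffOne p
  have hc1 := coeffOne_le h0 h1
  have h3 := coeffThree_nonneg h0 h1
  have hthree := mul_le_mul_of_nonneg_left (qk_three_le_half G) h3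
  have hq0 := qk_zero_pos G
  have hq2 := qk_nonneg 2 G
  have hbr : (1 + coeffOne p * (bridges G).card) * qk n 0 G ≤ 1 / 16 := by
    obtain hm | hm | hm : (bridges G).card = 0 ∨ (bridges G).card = 1 ∨ 2 ≤ (bridges G).card := by
      omega
    · obtain ⟨T, hTG, hT, hT4⟩ :=
        exists_shattered_four hG (Finset.card_eq_zero.1 hm) hc hodd hK
      have := hT.qk_zero_le hTG
      rw [hT4] at this
      rw [hm]
      norm_num at this ⊢
      exact this
    · have := qk_zero_le_of_card (j := 2) hG le_rfl (by omega)
      rw [hm] at this ⊢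
      norm_num at this ⊢
      nlinarith
    · have hm' : (2 : ℝ) ≤ (bridges G).card := by exact_mod_cast hm
      have : (1 + coeffOne p * (bridges G).card) * qk n 0 G ≤ 0 :=
        mul_nonpos_of_nonpos_of_nonneg (by nlinarith) hq0.le
      linarith
  obtain hc2 | hc2 := le_total 0 (coeffTwo p)
  · refine (extremal_add_le_odd_coeffTwo h0 h1).trans
      (le_lamP_of_odd h0 h1 hodd hc (by positivity) ?_)
    have := mul_le_mul_of_nonneg_left
      (qk_le_three_quarters hG (Finset.card_pos.1 (by omega)) 2) hc2
    rw [cutWeight_eq_bridges]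
    linarith
  · refine (extremal_add_le_odd h0 h1).trans
      (le_lamP_of_odd h0 h1 hodd hc (by positivity) ?_)
    have := mul_nonpos_of_nonpos_of_nonneg hc2 hq2
    rw [cutWeight_eq_bridges]
    linarith

theorem gap_of_card_three {p : ℝ} (h0 : 31 / 125 ≤ p) (h1 : p < 1 / 2) (hG : Loopless G)
    (hc : G.card = 3) (hT : ¬ IsTriangle G) : extremal p + 1 / 100000 ≤ lamP n p G := by
  have hm : (bridges G).card ≠ 0 := fun h =>
    hT (isTriangle_of_bridges_eq_empty hG (Finset.card_eq_zero.1 h) hc)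
  refine (extremal_add_le_three_forest h0 h1).trans (le_of_eq ?_)
  rw [lamP_eq, (shattered_of_card_le hG (by omega)).cutWeight_eq, hc]
  norm_num [Nat.choose]
  ring

theorem card_eq_two_iff (hG : Loopless G) : G.card = 2 ↔ IsPathTwo G ∨ IsTwoDisjointEdges G := by
  constructor
  · intro h
    obtain ⟨e, f, hef, rfl⟩ := Finset.card_eq_two.1 h
    have he := hG e (by simp)
    have hf := hG f (by simp)
    induction e with
    | _ a b =>
    induction f with
    | _ c d =>
    rw [Sym2.mk_isDiag_iff] at he hf
    rw [ne_eq, Sym2.eq_iff] at hef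
    by_cases hac : a = c
    · subst hac
      exact .inl ⟨b, a, d, Ne.symm he, by grind, hf, by rw [Sym2.eq_swap]⟩
    by_cases had : a = d
    · subst had
      exact .inl ⟨b, a, c, Ne.symm he, by grind, hac, by
        rw [Sym2.eq_swap, Sym2.eq_swap (a := c)]⟩
    by_cases hbc : b = c
    · subst hbc
      exact .inl ⟨a, b, d, he, had, hf, rfl⟩
    by_cases hbd : b = d
    · subst hbd
      exact .inl ⟨a, b, c, he, hac, hbc, by rw [Sym2.eq_swap (a := c)]⟩
    · exact .inr ⟨a, b, c, d, he, hac, had, hbc, hbd, hf, rfl⟩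
  · rintro (⟨a, b, c, hab, hac, hbc, rfl⟩ | ⟨a, b, c, d, hab, hac, had, hbc, hbd, hcd, rfl⟩)
    · rw [Finset.card_pair]
      rw [ne_eq, Sym2.eq_iff]
      grind
    · rw [Finset.card_pair]
      rw [ne_eq, Sym2.eq_iff]
      grind

theorem exceptional_iff (hG : Loopless G) :
    (G.card = 1 ∨ IsPathTwo G ∨ IsTwoDisjointEdges G ∨ IsTriangle G) ↔
      (G.card = 1 ∨ G.card = 2 ∨ IsTriangle G) := by
  rw [card_eq_two_iff hG]
  tauto

theorem gap_of_not_exceptional {p : ℝ} (h0 : 31 / 125 ≤ p) (h1 : p < 1 / 2) (hG : Loopless G)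
    (hne : G ≠ ∅) (hex : ¬ (G.card = 1 ∨ G.card = 2 ∨ IsTriangle G))
    (hS : ¬ (Shattered G ∧ G.card = 4)) (hK : ¬ IsK4Minus G) :
    extremal p + 1 / 100000 ≤ lamP n p G := by
  have hpos := Finset.card_pos.2 (Finset.nonempty_iff_ne_empty.2 hne)
  push Not at hex
  obtain ⟨hone, htwo, hT⟩ := hex
  obtain h3 | h4 : G.card = 3 ∨ 4 ≤ G.card := by omega
  · exact gap_of_card_three h0 h1 hG h3 hT
  obtain heven | hodd := Nat.even_or_odd G.card
  · exact gap_of_even h0 h1 hG h4 heven hS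
  · have h5 : 5 ≤ G.card := by
      obtain ⟨t, ht⟩ := hodd
      omega
    exact gap_of_odd h0 h1 hG h5 hodd hK

theorem extremal_lt_lamP {p : ℝ} (h0 : 31 / 125 ≤ p) (h1 : p < 1 / 2) (hG : Loopless G)
    (hne : G ≠ ∅) (hex : ¬ (G.card = 1 ∨ G.card = 2 ∨ IsTriangle G)) :
    extremal p < lamP n p G := by
  by_cases hS : Shattered G ∧ G.card = 4
  · exact extremal_lt_lamP_of_shattered_four h0 h1 hS.1 hS.2
  by_cases hK : IsK4Minus G
  · exact extremal_lt_lamP_of_isK4Minus h0 h1 hK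
  · linarith [gap_of_not_exceptional h0 h1 hG hne hex hS hK]

theorem lamP_of_exceptional {p : ℝ} (h0 : 31 / 125 ≤ p) (h1 : p < 1 / 2) (hG : Loopless G)
    (hex : G.card = 1 ∨ G.card = 2 ∨ IsTriangle G) : lamP n p G = extremal p := by
  obtain h | h | h := hex
  · exact lamP_of_card_one h0 h1 hG h
  · exact lamP_of_card_two h0 h1 hG h
  · exact lamP_of_isTriangle h0 h1 hG h

theorem skewed_occ_spectrum :
    ∃ γ' : ℝ, 0 < γ' ∧
      ∀ (n : ℕ) (p : ℝ), 0.248 ≤ p → p < 1 / 2 →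
        ∀ G : Finset (Sym2 (Fin n)), G ⊆ edgeFinset n →
          (lamP n p (∅ : Finset (Sym2 (Fin n))) = 1) ∧
          (G ≠ ∅ →
            (lamP n p G ≥ -(p ^ 3) / (1 - p ^ 3) ∧
              (lamP n p G = -(p ^ 3) / (1 - p ^ 3) ↔
                (G.card = 1 ∨ IsPathTwo G ∨ IsTwoDisjointEdges G ∨ IsTriangle G)))) ∧
          (G ≠ ∅ →
            ¬(G.card = 1 ∨ IsPathTwo G ∨ IsTwoDisjointEdges G ∨ IsTriangle G) →
            ¬(IsForest G ∧ G.card = 4) →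
            ¬IsK4Minus G →
            lamP n p G ≥ -(p ^ 3) / (1 - p ^ 3) + γ') := by
  refine ⟨1 / 100000, by norm_num, fun n p hp h1 G hGE => ?_⟩
  have h0 : 31 / 125 ≤ p := by norm_num at hp ⊢; exact hp
  have hG : Loopless G := fun e he => (Finset.mem_filter.1 (hGE he)).2
  rw [exceptional_iff hG]
  refine ⟨lamP_empty p, fun hne => ⟨?_, ?_, lamP_of_exceptional h0 h1 hG⟩,
    fun hne hex hF hK => ?_⟩
  · by_cases hex : G.card = 1 ∨ G.card = 2 ∨ IsTriangle G
    · exact (lamP_of_exceptional h0 h1 hG hex).ge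
    · exact (extremal_lt_lamP h0 h1 hG hne hex).le
  · intro heq
    by_contra hex
    exact (extremal_lt_lamP h0 h1 hG hne hex).ne' heq
  · exact gap_of_not_exceptional h0 h1 hG hne hex (fun h => hF ⟨h.1.isForest, h.2⟩) hK
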